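/- Let ν be a Borel probability measure on [0,∞) with ∫₀^∞ s dν(s) = 1, g(z) = ∫₀^∞ e^{−zs} dν(s), g'(z) = −∫₀^∞ s e^{−zs} dν(s), g''(0) := ∫₀^∞ s² dν(s) < ∞, and assume ∫₁^∞ g(s)/s ds < ∞. For α ∈ [0,1] set c_α[g] := (1/Γ(2−α)) ∫₀^∞ (g(z) − e^{−z}) z^{−1−α} dz. Then c₀[g] + c₁[g] = ∫₀^∞ (g(z) + g'(z))/z dz, and for every α ∈ (0,1): c_α[g] ≤ (1−α) c₀[g] + α c₁[g]. -/

import Mathlib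

open MeasureTheory Real Set Filter

/-- Kernel of the second-order Taylor remainder at the base point `1`: integrated against the
second derivative of a function in `t` over `(0, ∞)`, it gives the remainder at `s`. -/
noncomputable def taylorKernel (s t : ℝ) : ℝ :=
  if 1 < t then max (s - t) 0 else max (t - s) 0

theorem taylorKernel_nonneg (s t : ℝ) : 0 ≤ taylorKernel s t := by
  unfold taylorKernel
  split_ifs <;> exact le_max_right _ _

theorem measurable_taylorKernel : Measurable (fun p : ℝ × ℝ => taylorKernel p.1 p.2) := by
  unfold taylorKernel
  refine Measurable.ite (measurableSet_lt measurable_const measurable_snd) ?_ ?_ <;> fun_prop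

theorem intervalIntegral_sub_mul_sq_mul_exp (z s : ℝ) :
    ∫ t in (1:ℝ)..s, (s - t) * (z ^ 2 * exp (-z * t)) =
      exp (-z * s) - exp (-z) + z * (s - 1) * exp (-z) := by
  have hd : ∀ t : ℝ, HasDerivAt (fun t => (1 - (s - t) * z) * exp (-z * t))
      ((s - t) * (z ^ 2 * exp (-z * t))) t := by
    intro t
    have h1 : HasDerivAt (fun t : ℝ => exp (-z * t)) (exp (-z * t) * (-z * 1)) t :=
      ((hasDerivAt_id' t).const_mul (-z)).exp
    have h2 : HasDerivAt (fun t : ℝ => 1 - (s - t) * z) (-(-1 * z)) t :=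
      (((hasDerivAt_id' t).const_sub s).mul_const z).const_sub 1
    exact (h2.mul h1).congr_deriv (by ring)
  rw [intervalIntegral.integral_eq_sub_of_hasDerivAt (fun t _ => hd t)
    (Continuous.intervalIntegrable (by fun_prop) _ _)]
  simp only [mul_one]
  ring

theorem lintegral_taylorKernel_mul_exp {z s : ℝ} (hs : 0 ≤ s) :
    ∫⁻ t in Ioi (0:ℝ), ENNReal.ofReal (taylorKernel s t * (z ^ 2 * exp (-z * t))) =
      ENNReal.ofReal (exp (-z * s) - exp (-z) + z * (s - 1) * exp (-z)) := by
  rw [← intervalIntegral_sub_mul_sq_mul_exp]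
  rcases le_total 1 s with h | h
  · have h1 : (fun t => ENNReal.ofReal (taylorKernel s t * (z ^ 2 * exp (-z * t)))) =
        (Ioc 1 s).indicator
          (fun t => ENNReal.ofReal ((s - t) * (z ^ 2 * exp (-z * t)))) := by
      ext t
      by_cases ht : t ∈ Ioc 1 s
      · rw [indicator_of_mem ht, taylorKernel, if_pos ht.1, max_eq_left (by linarith [ht.2])]
      · rw [indicator_of_notMem ht, taylorKernel]
        split_ifs with h'
        · rw [max_eq_right (by by_contra hh; exact ht ⟨h', by linarith⟩)]; simp
        · rw [max_eq_right (by linarith)]; simp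
    rw [h1, setLIntegral_indicator measurableSet_Ioc,
      inter_eq_left.2 (Ioc_subset_Ioi_self.trans (Ioi_subset_Ioi zero_le_one)),
      intervalIntegral.integral_of_le h,
      ofReal_integral_eq_lintegral_ofReal]
    · exact (Continuous.integrableOn_Icc (by fun_prop)).mono_set Ioc_subset_Icc_self
    · filter_upwards [ae_restrict_mem measurableSet_Ioc] with t ht
      have := sub_nonneg.2 ht.2
      simp only [Pi.zero_apply]
      positivity
  · have h1 : (fun t => ENNReal.ofReal (taylorKernel s t * (z ^ 2 * exp (-z * t)))) =
        (Ioc s 1).indicator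
          (fun t => ENNReal.ofReal (-((s - t) * (z ^ 2 * exp (-z * t))))) := by
      ext t
      by_cases ht : t ∈ Ioc s 1
      · rw [indicator_of_mem ht, taylorKernel, if_neg (not_lt.2 ht.2),
          max_eq_left (by linarith [ht.1])]
        congr 1; ring
      · rw [indicator_of_notMem ht, taylorKernel]
        split_ifs with h'
        · rw [max_eq_right (by linarith)]; simp
        · rw [max_eq_right (by by_contra hh; exact ht ⟨by linarith, by linarith⟩)]; simp
    rw [h1, setLIntegral_indicator measurableSet_Ioc,
      inter_eq_left.2 (Ioc_subset_Ioi_self.trans (Ioi_subset_Ioi hs)),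
      intervalIntegral.integral_of_ge h,
      ← integral_neg, ofReal_integral_eq_lintegral_ofReal]
    · exact (Continuous.integrableOn_Icc (by fun_prop)).mono_set Ioc_subset_Icc_self
    · filter_upwards [ae_restrict_mem measurableSet_Ioc] with t ht
      have h2 : 0 ≤ t - s := by linarith [ht.1]
      have : 0 ≤ (t - s) * (z ^ 2 * exp (-z * t)) := by positivity
      simp only [Pi.zero_apply]
      linarith

theorem lintegral_sq_mul_exp_mul_rpow {α t : ℝ} (hα : α < 2) (ht : 0 < t) :
    ∫⁻ z in Ioi (0:ℝ), ENNReal.ofReal (z ^ 2 * exp (-z * t) * z ^ (-1 - α)) =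
      ENNReal.ofReal (Gamma (2 - α) * t ^ (α - 2)) := by
  have hpos : 0 < Gamma (2 - α) * t ^ (α - 2) :=
    mul_pos (Gamma_pos_of_pos (by linarith)) (rpow_pos_of_pos ht _)
  have h := integral_rpow_mul_exp_neg_mul_Ioi (a := 2 - α) (by linarith) ht
  rw [one_div, inv_rpow ht.le, ← rpow_neg ht.le, neg_sub, mul_comm] at h
  rw [← h, ofReal_integral_eq_lintegral_ofReal]
  · refine setLIntegral_congr_fun measurableSet_Ioi fun z (hz : 0 < z) => ?_
    congr 1
    rw [show 2 - α - 1 = 2 + (-1 - α) by ring, rpow_add hz, rpow_two, neg_mul, mul_comm z t]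
    ring
  · by_contra hn
    rw [integral_undef hn] at h
    exact hpos.ne h
  · filter_upwards [ae_restrict_mem measurableSet_Ioi] with z hz
    have : 0 < z := hz
    simp only [Pi.zero_apply]
    positivity

theorem exp_neg_sub_one_add_nonneg (x : ℝ) : 0 ≤ exp (-x) - 1 + x := by
  linarith [add_one_le_exp (-x)]

theorem exp_neg_sub_one_add_le_sq {x : ℝ} (hx : 0 ≤ x) : exp (-x) - 1 + x ≤ x ^ 2 := by
  have h1 := add_one_le_exp x
  have h2 : exp (-x) * exp x = 1 := by rw [← exp_add]; simp
  have h3 := exp_pos (-x)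
  have h4 : exp (-x) * (1 + x) ≤ 1 := by nlinarith
  have h5 : exp (-x) ≤ 1 / (1 + x) := by rw [le_div_iff₀ (by linarith)]; exact h4
  have h6 : 1 / (1 + x) ≤ 1 - x + x ^ 2 := by
    rw [div_le_iff₀ (by linarith)]; nlinarith [pow_nonneg hx 3]
  linarith

section Laplace

variable {ν : Measure ℝ}

theorem integrable_mul_exp_neg_mul (hpos : ∀ᵐ s ∂ν, 0 ≤ s)
    (hint : Integrable (fun s => s) ν) {z : ℝ} (hz : 0 ≤ z) :
    Integrable (fun s => s * exp (-z * s)) ν := by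
  refine hint.mono (by fun_prop) ?_
  filter_upwards [hpos] with s hs
  rw [norm_mul, norm_of_nonneg (exp_pos _).le]
  exact mul_le_of_le_one_right (norm_nonneg _) (by rw [exp_le_one_iff]; nlinarith)

variable [IsProbabilityMeasure ν]

theorem integrable_exp_neg_mul (hpos : ∀ᵐ s ∂ν, 0 ≤ s) {z : ℝ} (hz : 0 ≤ z) :
    Integrable (fun s => exp (-z * s)) ν := by
  refine Integrable.of_bound (C := 1) (by fun_prop) ?_
  filter_upwards [hpos] with s hs
  rw [norm_of_nonneg (exp_pos _).le, exp_le_one_iff]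
  nlinarith

theorem hasDerivAt_integral_exp_neg_mul (hpos : ∀ᵐ s ∂ν, 0 ≤ s)
    (hint : Integrable (fun s => s) ν) {z : ℝ} (hz : 0 < z) :
    HasDerivAt (fun z => ∫ s, exp (-z * s) ∂ν) (-∫ s, s * exp (-z * s) ∂ν) z := by
  rw [← integral_neg]
  refine (hasDerivAt_integral_of_dominated_loc_of_deriv_le (Ioi_mem_nhds hz)
    (bound := fun s => ‖s‖) (F' := fun z s => -(s * exp (-z * s))) ?_ ?_ ?_ ?_ hint.norm ?_).2
  · exact Eventually.of_forall fun x => by fun_prop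
  · exact integrable_exp_neg_mul hpos hz.le
  · fun_prop
  · filter_upwards [hpos] with s hs x hx
    have hx : 0 < x := hx
    rw [norm_neg, norm_mul, norm_of_nonneg (exp_pos _).le]
    exact mul_le_of_le_one_right (norm_nonneg _) (by rw [exp_le_one_iff]; nlinarith)
  · refine Eventually.of_forall fun s x _ => ?_
    have h : HasDerivAt (fun x : ℝ => exp (-x * s)) (exp (-x * s) * (-1 * s)) x :=
      ((hasDerivAt_neg x).mul_const s).exp
    exact h.congr_deriv (by ring)

theorem integral_exp_neg_mul_sub_exp_neg (hpos : ∀ᵐ s ∂ν, 0 ≤ s)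
    (hint : Integrable (fun s => s) ν) (hmean : (∫ s, s ∂ν) = 1) {z : ℝ} (hz : 0 ≤ z) :
    Integrable (fun s => exp (-z * s) - exp (-z) + z * (s - 1) * exp (-z)) ν ∧
    ∫ s, (exp (-z * s) - exp (-z) + z * (s - 1) * exp (-z)) ∂ν =
      (∫ s, exp (-z * s) ∂ν) - exp (-z) := by
  have h1 := integrable_exp_neg_mul hpos hz
  have h2 : Integrable (fun s => z * (s - 1) * exp (-z)) ν :=
    ((hint.sub (integrable_const 1)).const_mul z).mul_const _
  have h3 : Integrable (fun s => exp (-z * s) - exp (-z)) ν := h1.sub (integrable_const _)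
  refine ⟨h3.add h2, ?_⟩
  rw [integral_add h3 h2, integral_sub h1 (integrable_const _), integral_mul_const,
    integral_const_mul, integral_sub hint (integrable_const 1), hmean]
  simp

theorem exp_neg_mul_sub_exp_neg_nonneg (z s : ℝ) :
    0 ≤ exp (-z * s) - exp (-z) + z * (s - 1) * exp (-z) := by
  have h : exp (-z * s) = exp (-z) * exp (-(z * (s - 1))) := by
    rw [← exp_add]; congr 1; ring
  rw [h]
  nlinarith [exp_neg_sub_one_add_nonneg (z * (s - 1)), exp_pos (-z)]

theorem exp_neg_le_integral_exp_neg_mul (hpos : ∀ᵐ s ∂ν, 0 ≤ s)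
    (hint : Integrable (fun s => s) ν) (hmean : (∫ s, s ∂ν) = 1) {z : ℝ} (hz : 0 ≤ z) :
    exp (-z) ≤ ∫ s, exp (-z * s) ∂ν := by
  rw [← sub_nonneg, ← (integral_exp_neg_mul_sub_exp_neg hpos hint hmean hz).2]
  exact integral_nonneg fun s => exp_neg_mul_sub_exp_neg_nonneg z s

theorem integral_exp_neg_mul_sub_le_sq (hpos : ∀ᵐ s ∂ν, 0 ≤ s)
    (hint : Integrable (fun s => s) ν) (hmean : (∫ s, s ∂ν) = 1)
    (hm2 : Integrable (fun s => s ^ 2) ν) {z : ℝ} (hz : 0 ≤ z) :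
    (∫ s, exp (-z * s) ∂ν) - exp (-z) ≤ (∫ s, s ^ 2 ∂ν) * z ^ 2 := by
  have h1 := integrable_exp_neg_mul hpos hz
  have h3 : Integrable (fun s => exp (-z * s) - 1) ν := h1.sub (integrable_const _)
  have h : ∫ s, (exp (-z * s) - 1 + z * s) ∂ν ≤ ∫ s, s ^ 2 * z ^ 2 ∂ν := by
    refine integral_mono_ae (h3.add (hint.const_mul z)) (hm2.mul_const _) ?_
    filter_upwards [hpos] with s hs
    have := exp_neg_sub_one_add_le_sq (mul_nonneg hz hs)
    simp only [neg_mul]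
    linarith [mul_pow z s 2]
  rw [integral_add h3 (hint.const_mul z), integral_sub h1 (integrable_const _),
    integral_const_mul, integral_mul_const, hmean] at h
  simp only [integral_const, probReal_univ, smul_eq_mul, mul_one] at h
  linarith [exp_neg_sub_one_add_nonneg z]

theorem integrableOn_integral_exp_mul_rpow (hpos : ∀ᵐ s ∂ν, 0 ≤ s)
    (hint : Integrable (fun s => s) ν) (hmean : (∫ s, s ∂ν) = 1)
    (hm2 : Integrable (fun s => s ^ 2) ν)
    (hgtail : IntegrableOn (fun z => (∫ s, exp (-z * s) ∂ν) / z) (Ioi 1))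
    {α : ℝ} (hα : α ∈ Icc (0:ℝ) 1) :
    IntegrableOn (fun z => ((∫ s, exp (-z * s) ∂ν) - exp (-z)) * z ^ (-1 - α)) (Ioi 0) := by
  have hmeas : AEStronglyMeasurable
      (fun z => ((∫ s, exp (-z * s) ∂ν) - exp (-z)) * z ^ (-1 - α))
      (volume.restrict (Ioi 0)) := by
    refine ContinuousOn.aestronglyMeasurable (fun z hz => ?_) measurableSet_Ioi
    have h1 := (hasDerivAt_integral_exp_neg_mul hpos hint hz).continuousAt
    have h2 := Real.continuousAt_rpow_const z (-1 - α) (Or.inl (ne_of_gt hz))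
    exact ((h1.sub (by fun_prop)).mul h2).continuousWithinAt
  rw [← Ioc_union_Ioi_eq_Ioi (zero_le_one' ℝ)]
  refine IntegrableOn.union ?_ ?_
  · refine Integrable.mono' (integrable_const (∫ s, s ^ 2 ∂ν))
      (hmeas.mono_measure (Measure.restrict_mono Ioc_subset_Ioi_self le_rfl)) ?_
    filter_upwards [ae_restrict_mem measurableSet_Ioc] with z hz
    have hz0 : 0 < z := hz.1
    have h0 := exp_neg_le_integral_exp_neg_mul hpos hint hmean hz0.le
    have h1 := integral_exp_neg_mul_sub_le_sq hpos hint hmean hm2 hz0.le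
    have h2 : z ^ (-1 - α) ≤ z ^ (-2 : ℝ) :=
      rpow_le_rpow_of_exponent_ge hz0 hz.2 (by linarith [hα.2])
    rw [norm_of_nonneg (mul_nonneg (sub_nonneg.2 h0) (rpow_nonneg hz0.le _))]
    calc _ ≤ ((∫ s, s ^ 2 ∂ν) * z ^ 2) * z ^ (-2 : ℝ) :=
          mul_le_mul h1 h2 (rpow_nonneg hz0.le _) (by linarith)
      _ = _ := by rw [rpow_neg hz0.le, rpow_two]; field_simp
  · refine Integrable.mono' hgtail
      (hmeas.mono_measure (Measure.restrict_mono (Ioi_subset_Ioi zero_le_one) le_rfl)) ?_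
    filter_upwards [ae_restrict_mem measurableSet_Ioi] with z hz
    have hz1 : 1 < z := hz
    have hz0 : 0 < z := by linarith
    have h0 := exp_neg_le_integral_exp_neg_mul hpos hint hmean hz0.le
    have h2 : z ^ (-1 - α) ≤ z ^ (-1 : ℝ) :=
      rpow_le_rpow_of_exponent_le hz1.le (by linarith [hα.1])
    rw [norm_of_nonneg (mul_nonneg (sub_nonneg.2 h0) (rpow_nonneg hz0.le _)), div_eq_mul_inv,
      ← rpow_neg_one]
    exact mul_le_mul (by linarith [exp_pos (-z)]) h2 (rpow_nonneg hz0.le _)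
      (by linarith [exp_pos (-z)])

theorem ofReal_integral_exp_neg_mul_sub (hpos : ∀ᵐ s ∂ν, 0 ≤ s)
    (hint : Integrable (fun s => s) ν) (hmean : (∫ s, s ∂ν) = 1) {z : ℝ} (hz : 0 ≤ z) :
    ENNReal.ofReal ((∫ s, exp (-z * s) ∂ν) - exp (-z)) =
      ∫⁻ t in Ioi (0:ℝ), (∫⁻ s, ENNReal.ofReal (taylorKernel s t) ∂ν) *
        ENNReal.ofReal (z ^ 2 * exp (-z * t)) := by
  obtain ⟨hi, he⟩ := integral_exp_neg_mul_sub_exp_neg hpos hint hmean hz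
  rw [← he, ofReal_integral_eq_lintegral_ofReal hi
    (Eventually.of_forall fun s => exp_neg_mul_sub_exp_neg_nonneg z s)]
  have h1 : ∫⁻ s, ENNReal.ofReal (exp (-z * s) - exp (-z) + z * (s - 1) * exp (-z)) ∂ν =
      ∫⁻ s, (∫⁻ t in Ioi (0:ℝ),
        ENNReal.ofReal (taylorKernel s t * (z ^ 2 * exp (-z * t)))) ∂ν := by
    refine lintegral_congr_ae ?_
    filter_upwards [hpos] with s hs
    exact (lintegral_taylorKernel_mul_exp hs).symm
  have hk := measurable_taylorKernel
  rw [h1, lintegral_lintegral_swap]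
  · refine lintegral_congr fun t => ?_
    have hkt : Measurable fun s => ENNReal.ofReal (taylorKernel s t) :=
      (hk.comp (measurable_id.prodMk measurable_const)).ennreal_ofReal
    rw [← lintegral_mul_const _ hkt]
    refine lintegral_congr fun s => ?_
    exact ENNReal.ofReal_mul (taylorKernel_nonneg s t)
  · exact (hk.mul (by fun_prop)).ennreal_ofReal.aemeasurable

theorem ofReal_integral_exp_mul_rpow_div_Gamma (hpos : ∀ᵐ s ∂ν, 0 ≤ s)
    (hint : Integrable (fun s => s) ν) (hmean : (∫ s, s ∂ν) = 1)
    (hm2 : Integrable (fun s => s ^ 2) ν)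
    (hgtail : IntegrableOn (fun z => (∫ s, exp (-z * s) ∂ν) / z) (Ioi 1))
    {α : ℝ} (hα : α ∈ Icc (0:ℝ) 1) :
    ENNReal.ofReal (1 / Gamma (2 - α) *
      ∫ z in Ioi (0:ℝ), ((∫ s, exp (-z * s) ∂ν) - exp (-z)) * z ^ (-1 - α)) =
      ∫⁻ t in Ioi (0:ℝ), (∫⁻ s, ENNReal.ofReal (taylorKernel s t) ∂ν) *
        ENNReal.ofReal (t ^ (α - 2)) := by
  have hG : 0 < Gamma (2 - α) := Gamma_pos_of_pos (by linarith [hα.2])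
  have hw : Measurable fun t => ∫⁻ s, ENNReal.ofReal (taylorKernel s t) ∂ν :=
    measurable_taylorKernel.ennreal_ofReal.lintegral_prod_left'
  rw [ENNReal.ofReal_mul (by positivity), ofReal_integral_eq_lintegral_ofReal
    (integrableOn_integral_exp_mul_rpow hpos hint hmean hm2 hgtail hα)]
  swap
  · filter_upwards [ae_restrict_mem measurableSet_Ioi] with z hz
    exact mul_nonneg (sub_nonneg.2 (exp_neg_le_integral_exp_neg_mul hpos hint hmean
      (le_of_lt hz))) (rpow_nonneg (le_of_lt hz) _)
  have h1 : ∫⁻ z in Ioi (0:ℝ), ENNReal.ofReal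
        (((∫ s, exp (-z * s) ∂ν) - exp (-z)) * z ^ (-1 - α)) =
      ∫⁻ z in Ioi (0:ℝ), ∫⁻ t in Ioi (0:ℝ), (∫⁻ s, ENNReal.ofReal (taylorKernel s t) ∂ν) *
        ENNReal.ofReal (z ^ 2 * exp (-z * t) * z ^ (-1 - α)) := by
    refine setLIntegral_congr_fun measurableSet_Ioi fun z (hz : 0 < z) => ?_
    have hwz : Measurable fun t : ℝ =>
        (∫⁻ s, ENNReal.ofReal (taylorKernel s t) ∂ν) * ENNReal.ofReal (z ^ 2 * exp (-z * t)) :=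
      hw.mul (by fun_prop)
    rw [ENNReal.ofReal_mul (sub_nonneg.2
        (exp_neg_le_integral_exp_neg_mul hpos hint hmean hz.le)),
      ofReal_integral_exp_neg_mul_sub hpos hint hmean hz.le,
      ← lintegral_mul_const _ hwz]
    refine lintegral_congr fun t => ?_
    rw [mul_assoc, ENNReal.ofReal_mul (p := z ^ 2 * exp (-z * t)) (by positivity)]
  rw [h1, lintegral_lintegral_swap]
  · rw [← lintegral_const_mul']
    · refine setLIntegral_congr_fun measurableSet_Ioi fun t (ht : 0 < t) => ?_
      rw [lintegral_const_mul _ (by fun_prop),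
        lintegral_sq_mul_exp_mul_rpow (by linarith [hα.2]) ht, mul_left_comm,
        ← ENNReal.ofReal_mul (by positivity)]
      congr 2
      field_simp
    · exact ENNReal.ofReal_ne_top
  · exact ((hw.comp measurable_snd).mul (by fun_prop)).aemeasurable

theorem integral_sub_div_sq_eq (hpos : ∀ᵐ s ∂ν, 0 ≤ s)
    (hint : Integrable (fun s => s) ν) (hmean : (∫ s, s ∂ν) = 1)
    (hm2 : Integrable (fun s => s ^ 2) ν)
    (hgtail : IntegrableOn (fun z => (∫ s, exp (-z * s) ∂ν) / z) (Ioi 1)) :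
    IntegrableOn (fun z => (-(∫ s, s * exp (-z * s) ∂ν) + exp (-z)) * z⁻¹) (Ioi 0) ∧
    ∫ z in Ioi (0:ℝ), ((∫ s, exp (-z * s) ∂ν) - exp (-z)) * z ^ (-2 : ℝ) =
      ∫ z in Ioi (0:ℝ), (-(∫ s, s * exp (-z * s) ∂ν) + exp (-z)) * z⁻¹ := by
  have hI : IntegrableOn (fun z => (-(∫ s, s * exp (-z * s) ∂ν) + exp (-z)) * z⁻¹)
      (Ioi 0) := by
    have hmeas : AEStronglyMeasurable
        (fun z => (-(∫ s, s * exp (-z * s) ∂ν) + exp (-z)) * z⁻¹) volume := by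
      have h : StronglyMeasurable fun p : ℝ × ℝ => p.2 * exp (-p.1 * p.2) :=
        Measurable.stronglyMeasurable (by fun_prop)
      have h' := (h.integral_prod_right' (ν := ν)).measurable
      exact (Measurable.mul (h'.neg.add (by fun_prop)) (by fun_prop)).aestronglyMeasurable
    rw [← Ioc_union_Ioi_eq_Ioi (zero_le_one' ℝ)]
    refine IntegrableOn.union ?_ ?_
    · refine Integrable.mono' (integrable_const ((∫ s, s ^ 2 ∂ν) + 1)) hmeas.restrict ?_
      filter_upwards [ae_restrict_mem measurableSet_Ioc] with z hz
      have hz0 : 0 < z := hz.1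
      have h1 := integrable_mul_exp_neg_mul hpos hint hz0.le
      have hle : ∫ s, s * exp (-z * s) ∂ν ≤ ∫ s, s ∂ν := by
        refine integral_mono_ae h1 hint ?_
        filter_upwards [hpos] with s hs
        exact mul_le_of_le_one_right hs (by rw [exp_le_one_iff]; nlinarith)
      have hge : ∫ s, (s - s ^ 2 * z) ∂ν ≤ ∫ s, s * exp (-z * s) ∂ν := by
        refine integral_mono_ae (hint.sub (hm2.mul_const z)) h1 ?_
        filter_upwards [hpos] with s hs
        have := mul_le_mul_of_nonneg_left (add_one_le_exp (-z * s)) hs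
        linarith
      rw [integral_sub hint (hm2.mul_const z), integral_mul_const] at hge
      rw [hmean] at hge hle
      have h3 := add_one_le_exp (-z)
      have h4 : exp (-z) ≤ 1 := by rw [exp_le_one_iff]; linarith
      rw [norm_mul, norm_inv, norm_of_nonneg hz0.le, ← div_eq_mul_inv, div_le_iff₀ hz0,
        norm_eq_abs, abs_le]
      have h5 : 0 ≤ (∫ s, s ^ 2 ∂ν) * z :=
        mul_nonneg (integral_nonneg fun s => sq_nonneg s) hz0.le
      constructor <;> linarith
    · have hb : IntegrableOn (fun z : ℝ => 2 * z ^ (-2 : ℝ)) (Ioi 1) :=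
        ((integrableOn_Ioi_rpow_of_lt (by norm_num) one_pos)).const_mul 2
      refine Integrable.mono' hb hmeas.restrict ?_
      filter_upwards [ae_restrict_mem measurableSet_Ioi] with z hz
      have hz1 : 1 < z := hz
      have hz0 : 0 < z := by linarith
      have hxe : ∀ x : ℝ, x * exp (-x) ≤ 1 := fun x => by
        have h2 : exp (-x) * exp x = 1 := by rw [← exp_add]; simp
        nlinarith [add_one_le_exp x, exp_pos (-x)]
      have h1 := integrable_mul_exp_neg_mul hpos hint hz0.le
      have h0 : 0 ≤ ∫ s, s * exp (-z * s) ∂ν := by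
        refine integral_nonneg_of_ae ?_
        filter_upwards [hpos] with s hs
        exact mul_nonneg hs (exp_pos _).le
      have hle : ∫ s, s * exp (-z * s) ∂ν ≤ z⁻¹ := by
        calc _ ≤ ∫ _, z⁻¹ ∂ν := integral_mono h1 (integrable_const _) fun s => by
              have := hxe (z * s)
              simp only [neg_mul]
              rw [← one_div, le_div_iff₀ hz0]
              linarith
          _ = _ := by simp
      have he : exp (-z) ≤ z⁻¹ := by
        rw [← one_div, le_div_iff₀ hz0]; linarith [hxe z]
      have hp := exp_pos (-z)
      rw [norm_mul, norm_inv, norm_of_nonneg hz0.le, rpow_neg hz0.le, rpow_two, sq, mul_inv,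
        ← mul_assoc]
      refine mul_le_mul_of_nonneg_right ?_ (inv_nonneg.2 hz0.le)
      rw [norm_eq_abs, abs_le]
      constructor <;> linarith
  refine ⟨hI, ?_⟩
  have hJ := integrableOn_integral_exp_mul_rpow hpos hint hmean hm2 hgtail
    (α := 1) (by norm_num)
  rw [show (-1 - 1 : ℝ) = -2 by norm_num] at hJ
  have hder : ∀ z ∈ Ioi (0:ℝ), HasDerivAt
      (fun z => ((∫ s, exp (-z * s) ∂ν) - exp (-z)) * z⁻¹)
      ((-(∫ s, s * exp (-z * s) ∂ν) + exp (-z)) * z⁻¹ -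
        ((∫ s, exp (-z * s) ∂ν) - exp (-z)) * z ^ (-2 : ℝ)) z := by
    intro z hz
    have hz0 : 0 < z := hz
    have h1 := hasDerivAt_integral_exp_neg_mul hpos hint hz0
    have h2 := (hasDerivAt_neg z).exp
    refine ((h1.sub h2).mul (hasDerivAt_inv hz0.ne')).congr_deriv ?_
    simp only [Pi.sub_apply, rpow_neg hz0.le, rpow_two]
    ring
  have hlim0 : Tendsto (fun z => ((∫ s, exp (-z * s) ∂ν) - exp (-z)) * z⁻¹)
      (nhdsWithin 0 (Ioi 0)) (nhds 0) := by
    have hb : Tendsto (fun z : ℝ => (∫ s, s ^ 2 ∂ν) * z) (nhdsWithin 0 (Ioi 0)) (nhds 0) := by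
      have h : Continuous fun z : ℝ => (∫ s, s ^ 2 ∂ν) * z := by fun_prop
      simpa using (h.tendsto 0).mono_left nhdsWithin_le_nhds
    refine tendsto_of_tendsto_of_tendsto_of_le_of_le' tendsto_const_nhds hb ?_ ?_
    · filter_upwards [self_mem_nhdsWithin] with z hz
      have hz0 : 0 < z := hz
      exact mul_nonneg (sub_nonneg.2
        (exp_neg_le_integral_exp_neg_mul hpos hint hmean hz0.le)) (inv_nonneg.2 hz0.le)
    · filter_upwards [self_mem_nhdsWithin] with z hz
      have hz0 : 0 < z := hz
      rw [← div_eq_mul_inv, div_le_iff₀ hz0]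
      linarith [integral_exp_neg_mul_sub_le_sq hpos hint hmean hm2 hz0.le]
  have hlimtop : Tendsto (fun z => ((∫ s, exp (-z * s) ∂ν) - exp (-z)) * z⁻¹)
      atTop (nhds 0) := by
    refine tendsto_of_tendsto_of_tendsto_of_le_of_le' tendsto_const_nhds
      tendsto_inv_atTop_zero ?_ ?_
    · filter_upwards [eventually_gt_atTop 0] with z hz0
      exact mul_nonneg (sub_nonneg.2
        (exp_neg_le_integral_exp_neg_mul hpos hint hmean hz0.le)) (inv_nonneg.2 hz0.le)
    · filter_upwards [eventually_gt_atTop 0] with z hz0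
      refine mul_le_of_le_one_left (inv_nonneg.2 hz0.le) ?_
      have : ∫ s, exp (-z * s) ∂ν ≤ ∫ _, (1:ℝ) ∂ν := by
        refine integral_mono_ae (integrable_exp_neg_mul hpos hz0.le) (integrable_const _) ?_
        filter_upwards [hpos] with s hs
        rw [exp_le_one_iff]
        nlinarith
      simp only [integral_const, probReal_univ, smul_eq_mul, mul_one] at this
      linarith [exp_pos (-z)]
  have hcont : ContinuousWithinAt (fun z => ((∫ s, exp (-z * s) ∂ν) - exp (-z)) * z⁻¹)
      (Ici 0) 0 := by
    rw [← continuousWithinAt_Ioi_iff_Ici]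
    simpa [ContinuousWithinAt] using hlim0
  have h := integral_Ioi_of_hasDerivAt_of_tendsto hcont hder (hI.sub hJ) hlimtop
  rw [integral_sub hI hJ] at h
  simp only [inv_zero, mul_zero, sub_zero] at h
  linarith

end Laplace

theorem stmt_11
    (ν : Measure ℝ) [IsProbabilityMeasure ν]
    (hsupp : ν (Set.Iio 0) = 0)
    (hint : Integrable (fun s => s) ν)
    (hmean : (∫ s, s ∂ν) = 1)
    (hm2 : Integrable (fun s => s ^ 2) ν)
    (g : ℝ → ℝ) (hg : ∀ z : ℝ, g z = ∫ s, Real.exp (-z * s) ∂ν)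
    (g' : ℝ → ℝ) (hg' : ∀ z : ℝ, g' z = -∫ s, s * Real.exp (-z * s) ∂ν)
    (hgtail : IntegrableOn (fun s => g s / s) (Set.Ioi 1))
    (c : ℝ → ℝ)
    (hc : ∀ α : ℝ, c α = (1 / Real.Gamma (2 - α)) *
        ∫ z in Set.Ioi (0:ℝ), (g z - Real.exp (-z)) * z ^ (-1 - α)) :
    c 0 + c 1 = (∫ z in Set.Ioi (0:ℝ), (g z + g' z) / z) ∧
    ∀ α ∈ Set.Ioo (0:ℝ) 1, c α ≤ (1 - α) * c 0 + α * c 1 := by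
  have hpos : ∀ᵐ s ∂ν, 0 ≤ s := by
    rw [ae_iff]
    simp only [not_le]
    exact hsupp
  simp only [hg] at hgtail hc
  constructor
  · obtain ⟨hI, he⟩ := integral_sub_div_sq_eq hpos hint hmean hm2 hgtail
    have hJ := integrableOn_integral_exp_mul_rpow hpos hint hmean hm2 hgtail
      (α := 0) (by norm_num)
    rw [hc, hc, show (-1 - 1 : ℝ) = -2 by norm_num, he, show (2 - 0 : ℝ) = 2 by norm_num,
      show (2 - 1 : ℝ) = 1 by norm_num, Gamma_two, Gamma_one, div_one, one_mul, one_mul,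
      ← integral_add hJ hI]
    refine setIntegral_congr_fun measurableSet_Ioi fun z (hz : 0 < z) => ?_
    simp only [hg, hg', sub_zero, rpow_neg_one]
    ring
  · intro α hα
    have hmain : ∀ β ∈ Icc (0:ℝ) 1, ENNReal.ofReal (c β) =
        ∫⁻ t in Ioi (0:ℝ), (∫⁻ s, ENNReal.ofReal (taylorKernel s t) ∂ν) *
          ENNReal.ofReal (t ^ (β - 2)) := fun β hβ => by
      rw [hc]
      exact ofReal_integral_exp_mul_rpow_div_Gamma hpos hint hmean hm2 hgtail hβ
    have hnn : ∀ β ∈ Icc (0:ℝ) 1, 0 ≤ c β := fun β hβ => by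
      rw [hc]
      refine mul_nonneg (one_div_nonneg.2 (Gamma_pos_of_pos (by linarith [hβ.2])).le)
        (setIntegral_nonneg measurableSet_Ioi fun z (hz : 0 < z) => ?_)
      exact mul_nonneg (sub_nonneg.2 (exp_neg_le_integral_exp_neg_mul hpos hint hmean hz.le))
        (rpow_nonneg hz.le _)
    have hα0 : 0 ≤ 1 - α := by linarith [hα.2]
    have h0 := hnn 0 (by norm_num)
    have h1 := hnn 1 (by norm_num)
    have hw : Measurable fun t => ∫⁻ s, ENNReal.ofReal (taylorKernel s t) ∂ν :=
      measurable_taylorKernel.ennreal_ofReal.lintegral_prod_left'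
    have hwt : ∀ β : ℝ, Measurable fun t : ℝ =>
        (∫⁻ s, ENNReal.ofReal (taylorKernel s t) ∂ν) * ENNReal.ofReal (t ^ (β - 2)) :=
      fun β => hw.mul (by fun_prop)
    rw [← ENNReal.ofReal_le_ofReal_iff (by have := hα.1; positivity),
      ENNReal.ofReal_add (mul_nonneg hα0 h0) (mul_nonneg hα.1.le h1),
      ENNReal.ofReal_mul hα0, ENNReal.ofReal_mul hα.1.le, hmain α ⟨hα.1.le, hα.2.le⟩,
      hmain 0 (by norm_num), hmain 1 (by norm_num),
      ← lintegral_const_mul _ (hwt 0), ← lintegral_const_mul _ (hwt 1),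
      ← lintegral_add_left ((hwt 0).const_mul _)]
    refine setLIntegral_mono' measurableSet_Ioi fun t (ht : 0 < t) => ?_
    rw [mul_left_comm, mul_left_comm (ENNReal.ofReal α), ← mul_add,
      ← ENNReal.ofReal_mul hα0, ← ENNReal.ofReal_mul hα.1.le,
      ← ENNReal.ofReal_add (by positivity) (mul_nonneg hα.1.le (by positivity))]
    gcongr
    have h := geom_mean_le_arith_mean2_weighted hα0 hα.1.le (rpow_nonneg ht.le (0 - 2))
      (rpow_nonneg ht.le (1 - 2)) (by ring)
    rwa [← rpow_mul ht.le, ← rpow_mul ht.le, ← rpow_add ht,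
      show (0 - 2) * (1 - α) + (1 - 2) * α = α - 2 by ring] at h
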